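/- arXiv:1709.01962 — 2 statements merged into one kernel-verified Lean document; each statement's English description precedes it below -/
import Mathlib

section
/- Under the saw map setup, for every open interval (a,b) with Σ ∩ (a,b) ≠ ∅ there exist reals c < d with [c,d] ⊂ (a,b) and a natural number n such that Tⁿ([c,d]) = J*, Tⁿ(c) = 0, and the iterate T^i is affine on the segment [c,d] for each i ≤ n. -/
/-- `T` is affine (linear) on the segment `[a, b]`. -/
def AffOn (T : ℝ → ℝ) (a b : ℝ) : Prop :=
  ∃ m c : ℝ, ∀ x ∈ Set.Icc a b, T x = m * x + c

/-- The "saw map" setup: sequences `q, r, p`, the map `T`, fixed points `e k ∈ (q (k+1), r k)`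
and `ehat k ∈ (r k, q k)`, and the index `kstar`, subject to all standing assumptions. -/
structure SawMapSetup where
  q : ℕ → ℝ
  r : ℕ → ℝ
  p : ℕ → ℝ
  T : ℝ → ℝ
  e : ℕ → ℝ
  ehat : ℕ → ℝ
  kstar : ℕ
  hq_pos : ∀ k, 1 ≤ k → 0 < q k
  hr_pos : ∀ k, 0 < r k
  hq1r0 : q 1 < r 0
  hrq : ∀ k, 1 ≤ k → r k < q k
  hqr : ∀ k, 1 ≤ k → q (k + 1) < r k
  hq_lim : Filter.Tendsto q Filter.atTop (nhds 0)
  hr_lim : Filter.Tendsto r Filter.atTop (nhds 0)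
  hp_pos : ∀ k, 0 < p k
  hp_dec : ∀ k, p (k + 1) < p k
  hp0r0 : p 0 < r 0
  hpr : ∀ k, 1 ≤ k → r k < p k
  hT0 : T 0 = 0
  hTq : ∀ k, 1 ≤ k → T (q k) = 0
  hTr : ∀ k, T (r k) = p k
  haff0 : AffOn T (q 1) (r 0)
  haff1 : ∀ k, 1 ≤ k → AffOn T (q (k + 1)) (r k)
  haff2 : ∀ k, 1 ≤ k → AffOn T (r k) (q k)
  hTJ : Set.MapsTo T (Set.Icc 0 (r 0)) (Set.Icc 0 (r 0))
  halpha1 : ∀ k, 1 ≤ k → 1 < p k / (r k - q (k + 1))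
  he_mem : ∀ k, 1 ≤ k → e k ∈ Set.Ioo (q (k + 1)) (r k)
  he_fix : ∀ k, 1 ≤ k → T (e k) = e k
  he_uniq : ∀ k, 1 ≤ k → ∀ x ∈ Set.Ioo (q (k + 1)) (r k), T x = x → x = e k
  hehat_mem : ∀ k, 1 ≤ k → ehat k ∈ Set.Ioo (r k) (q k)
  hehat_fix : ∀ k, 1 ≤ k → T (ehat k) = ehat k
  hehat_uniq : ∀ k, 1 ≤ k → ∀ x ∈ Set.Ioo (r k) (q k), T x = x → x = ehat k
  halpha_mono : ∀ k, p k / (r k - q (k + 1)) < p (k + 1) / (r (k + 1) - q (k + 2))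
  hbeta_mono : ∀ k, 1 ≤ k → p k / (q k - r k) < p (k + 1) / (q (k + 1) - r (k + 1))
  hkstar : 1 ≤ kstar
  hp_e_big : ∀ k, kstar + 1 ≤ k → e (k - 1) < p k
  hp_e_small : 2 ≤ kstar → ∀ k, 2 ≤ k → k ≤ kstar → p k < e (k - 1)
  htech : ∀ k, 1 ≤ k → k < kstar → p k < q k + e k / (p (k - 1) / (r (k - 1) - q k))

namespace SawMapSetup

variable (S : SawMapSetup)

/-- Absolute value of the slope of `T` on `[q (k+1), r k]`. -/
noncomputable def alpha (k : ℕ) : ℝ := S.p k / (S.r k - S.q (k + 1))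

/-- Absolute value of the slope of `T` on `[r k, q k]`. -/
noncomputable def beta (k : ℕ) : ℝ := S.p k / (S.q k - S.r k)

/-- The invariant segment `J* = [0, p kstar]`. -/
def Jstar : Set ℝ := Set.Icc 0 (S.p S.kstar)

/-- The segment `J_k = [e k, p k]`. -/
def Jk (k : ℕ) : Set ℝ := Set.Icc (S.e k) (S.p k)

/-- The segment `G_k = [T (p k), p k]`. -/
def Gk (k : ℕ) : Set ℝ := Set.Icc (S.T (S.p k)) (S.p k)

/-- The set `Ω` of points of `J*` that are eventually mapped to `0`. -/
def Omega : Set ℝ := {x | x ∈ S.Jstar ∧ ∃ n, 1 ≤ n ∧ S.T^[n] x = 0}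

/-- The set `Σ`, the closure of `Ω`. -/
def Sig : Set ℝ := closure S.Omega

end SawMapSetup

open Set

namespace SawMapSetup

variable (S : SawMapSetup)

/-- `T^[n]` sends `c` to `0` and `d` to the right endpoint of `J*`, and every `T^[i]` with `i ≤ n`
is affine on the segment between `c` and `d`. The points `c` and `d` may come in either order. -/
def Fold (n : ℕ) (c d : ℝ) : Prop :=
  S.T^[n] c = 0 ∧ S.T^[n] d = S.p S.kstar ∧
    ∀ i ≤ n, ∃ a b : ℝ, ∀ x ∈ uIcc c d, S.T^[i] x = a * x + b

/-- The open interval `(u, v)` contains folds of both orientations. -/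
def HasFolds (u v : ℝ) : Prop :=
  (∃ n c d, u < c ∧ c < d ∧ d < v ∧ S.Fold n c d) ∧
    ∃ n c d, u < d ∧ d < c ∧ c < v ∧ S.Fold n c d

/-- The segment `[0, y]` contains an increasing fold. -/
def HasIncFold (y : ℝ) : Prop :=
  ∃ n c d, 0 ≤ c ∧ c < d ∧ d ≤ y ∧ S.Fold n c d

/-- `T` is affine and nonconstant on `[u, v]`, with values in `[0, p 0]`. -/
def IsLap (u v : ℝ) : Prop :=
  ∃ a b : ℝ, a ≠ 0 ∧ ∀ x ∈ Icc u v, S.T x = a * x + b ∧ S.T x ∈ Icc 0 (S.p 0)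

variable {S}

lemma Fold.pullback {n : ℕ} {c d u v a b : ℝ} (ha : ∀ x ∈ Icc u v, S.T x = a * x + b)
    (hc : c ∈ Icc u v) (hd : d ∈ Icc u v) (h : S.Fold n (a * c + b) (a * d + b)) :
    S.Fold (n + 1) c d := by
  obtain ⟨h0, hp, haff⟩ := h
  refine ⟨?_, ?_, ?_⟩
  · rwa [Function.iterate_succ_apply, ha c hc]
  · rwa [Function.iterate_succ_apply, ha d hd]
  · rintro (_ | i) hi
    · exact ⟨1, 0, fun x _ => by simp⟩
    · obtain ⟨a', b', h'⟩ := haff i (by omega)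
      refine ⟨a' * a, a' * b + b', fun x hx => ?_⟩
      rw [Function.iterate_succ_apply, ha x (uIcc_subset_Icc hc hd hx), h']
      · ring
      · rw [mem_uIcc] at hx ⊢
        rcases le_total 0 a with h0a | h0a <;> rcases hx with ⟨h1, h2⟩ | ⟨h1, h2⟩
        · left; constructor <;> nlinarith
        · right; constructor <;> nlinarith
        · right; constructor <;> nlinarith
        · left; constructor <;> nlinarith

lemma HasFolds.pullback_pos {u v a b : ℝ} (h0 : 0 < a) (ha : ∀ x ∈ Icc u v, S.T x = a * x + b)
    (h : S.HasFolds (a * u + b) (a * v + b)) : S.HasFolds u v := by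
  have key : ∀ y, a * u + b < y → y < a * v + b →
      ∃ x, a * x + b = y ∧ u < x ∧ x < v := fun y h1 h2 => by
    refine ⟨(y - b) / a, by rw [mul_div_cancel₀ _ h0.ne']; ring, ?_, ?_⟩
    · rw [lt_div_iff₀ h0]; linarith
    · rw [div_lt_iff₀ h0]; linarith
  obtain ⟨⟨n, c, d, h1, h2, h3, hF⟩, ⟨m, c', d', h1', h2', h3', hF'⟩⟩ := h
  obtain ⟨x, rfl, hx1, hx2⟩ := key c h1 (h2.trans h3)
  obtain ⟨y, rfl, hy1, hy2⟩ := key d (h1.trans h2) h3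
  obtain ⟨x', rfl, hx1', hx2'⟩ := key c' (h1'.trans h2') h3'
  obtain ⟨y', rfl, hy1', hy2'⟩ := key d' h1' (h2'.trans h3')
  exact ⟨⟨n + 1, x, y, hx1, by nlinarith, hy2,
      hF.pullback ha ⟨hx1.le, hx2.le⟩ ⟨hy1.le, hy2.le⟩⟩,
    ⟨m + 1, x', y', hy1', by nlinarith, hx2',
      hF'.pullback ha ⟨hx1'.le, hx2'.le⟩ ⟨hy1'.le, hy2'.le⟩⟩⟩

lemma HasFolds.pullback_neg {u v a b : ℝ} (h0 : a < 0) (ha : ∀ x ∈ Icc u v, S.T x = a * x + b)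
    (h : S.HasFolds (a * v + b) (a * u + b)) : S.HasFolds u v := by
  have key : ∀ y, a * v + b < y → y < a * u + b →
      ∃ x, a * x + b = y ∧ u < x ∧ x < v := fun y h1 h2 => by
    refine ⟨(y - b) / a, by rw [mul_div_cancel₀ _ h0.ne]; ring, ?_, ?_⟩
    · rw [lt_div_iff_of_neg h0]; linarith
    · rw [div_lt_iff_of_neg h0]; linarith
  obtain ⟨⟨n, c, d, h1, h2, h3, hF⟩, ⟨m, c', d', h1', h2', h3', hF'⟩⟩ := h
  obtain ⟨x, rfl, hx1, hx2⟩ := key c h1 (h2.trans h3)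
  obtain ⟨y, rfl, hy1, hy2⟩ := key d (h1.trans h2) h3
  obtain ⟨x', rfl, hx1', hx2'⟩ := key c' (h1'.trans h2') h3'
  obtain ⟨y', rfl, hy1', hy2'⟩ := key d' h1' (h2'.trans h3')
  exact ⟨⟨m + 1, x', y', hx1', by nlinarith, hy2',
      hF'.pullback ha ⟨hx1'.le, hx2'.le⟩ ⟨hy1'.le, hy2'.le⟩⟩,
    ⟨n + 1, x, y, hy1, by nlinarith, hx2,
      hF.pullback ha ⟨hx1.le, hx2.le⟩ ⟨hy1.le, hy2.le⟩⟩⟩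

lemma HasFolds.mono {u v u' v' : ℝ} (h : S.HasFolds u v) (hu : u' ≤ u) (hv : v ≤ v') :
    S.HasFolds u' v' := by
  obtain ⟨⟨n, c, d, h1, h2, h3, hF⟩, ⟨m, c', d', h1', h2', h3', hF'⟩⟩ := h
  exact ⟨⟨n, c, d, hu.trans_lt h1, h2, h3.trans_le hv, hF⟩,
    ⟨m, c', d', hu.trans_lt h1', h2', h3'.trans_le hv, hF'⟩⟩

lemma HasIncFold.mono {y z : ℝ} (h : S.HasIncFold y) (hyz : y ≤ z) : S.HasIncFold z := by
  obtain ⟨n, c, d, h1, h2, h3, hF⟩ := h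
  exact ⟨n, c, d, h1, h2, h3.trans hyz, hF⟩

variable (S)

lemma q_succ_lt_r (k : ℕ) : S.q (k + 1) < S.r k := by
  rcases k.eq_zero_or_pos with rfl | hk
  · exact S.hq1r0
  · exact S.hqr k hk

lemma p_antitone : Antitone S.p := antitone_nat_of_succ_le fun k => (S.hp_dec k).le

lemma exists_affine_rising (k : ℕ) : ∃ a b : ℝ, 0 < a ∧
    (∀ x ∈ Icc (S.q (k + 1)) (S.r k), S.T x = a * x + b) ∧
      a * S.q (k + 1) + b = 0 ∧ a * S.r k + b = S.p k := by
  have hlt := S.q_succ_lt_r k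
  obtain ⟨a, b, h⟩ : AffOn S.T (S.q (k + 1)) (S.r k) := by
    rcases k.eq_zero_or_pos with rfl | hk
    · exact S.haff0
    · exact S.haff1 k hk
  have h1 := h _ (left_mem_Icc.2 hlt.le)
  have h2 := h _ (right_mem_Icc.2 hlt.le)
  rw [S.hTq _ (by omega)] at h1
  rw [S.hTr] at h2
  have := S.hp_pos k
  exact ⟨a, b, by nlinarith, h, h1.symm, h2.symm⟩

lemma exists_affine_falling {k : ℕ} (hk : 1 ≤ k) : ∃ a b : ℝ, a < 0 ∧
    (∀ x ∈ Icc (S.r k) (S.q k), S.T x = a * x + b) ∧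
      a * S.q k + b = 0 ∧ a * S.r k + b = S.p k := by
  have hlt := S.hrq k hk
  obtain ⟨a, b, h⟩ := S.haff2 k hk
  have h1 := h _ (right_mem_Icc.2 hlt.le)
  have h2 := h _ (left_mem_Icc.2 hlt.le)
  rw [S.hTq _ hk] at h1
  rw [S.hTr] at h2
  have := S.hp_pos k
  exact ⟨a, b, by nlinarith, h, h1.symm, h2.symm⟩

lemma isLap_rising (k : ℕ) : S.IsLap (S.q (k + 1)) (S.r k) := by
  obtain ⟨a, b, h0, h, h1, h2⟩ := S.exists_affine_rising k
  have := S.p_antitone (Nat.zero_le k)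
  refine ⟨a, b, h0.ne', fun x hx => ⟨h x hx, ?_⟩⟩
  rw [h x hx]
  constructor <;> nlinarith [hx.1, hx.2]

lemma isLap_falling {k : ℕ} (hk : 1 ≤ k) : S.IsLap (S.r k) (S.q k) := by
  obtain ⟨a, b, h0, h, h1, h2⟩ := S.exists_affine_falling hk
  have := S.p_antitone (Nat.zero_le k)
  refine ⟨a, b, h0.ne, fun x hx => ⟨h x hx, ?_⟩⟩
  rw [h x hx]
  constructor <;> nlinarith [hx.1, hx.2]

lemma exists_q_succ_lt {x : ℝ} (hx : 0 < x) : ∃ k, S.q (k + 1) < x :=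
  ((Filter.tendsto_add_atTop_iff_nat 1).2 S.hq_lim |>.eventually (gt_mem_nhds hx)).exists

lemma exists_isLap_right {x : ℝ} (h0 : 0 < x) (hx : x < S.r 0) :
    ∃ u v, S.IsLap u v ∧ u ≤ x ∧ x < v := by
  classical
  have hex : ∃ k, S.q (k + 1) ≤ x := (S.exists_q_succ_lt h0).imp fun _ => le_of_lt
  have hspec := Nat.find_spec hex
  rcases hk : Nat.find hex with _ | k
  · rw [hk] at hspec
    exact ⟨_, _, S.isLap_rising 0, hspec, hx⟩
  · have hmin := not_le.1 (Nat.find_min hex (m := k) (by omega))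
    rw [hk] at hspec
    rcases lt_or_ge x (S.r (k + 1)) with h | h
    · exact ⟨_, _, S.isLap_rising (k + 1), hspec, h⟩
    · exact ⟨_, _, S.isLap_falling (by omega), h, hmin⟩

lemma exists_isLap_left {x : ℝ} (h0 : 0 < x) (hx : x < S.r 0) :
    ∃ u v, S.IsLap u v ∧ u < x ∧ x ≤ v := by
  classical
  have hex := S.exists_q_succ_lt h0
  have hspec := Nat.find_spec hex
  rcases hk : Nat.find hex with _ | k
  · rw [hk] at hspec
    exact ⟨_, _, S.isLap_rising 0, hspec, hx.le⟩
  · have hmin := not_lt.1 (Nat.find_min hex (m := k) (by omega))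
    rw [hk] at hspec
    rcases le_or_gt x (S.r (k + 1)) with h | h
    · exact ⟨_, _, S.isLap_rising (k + 1), hspec, h⟩
    · exact ⟨_, _, S.isLap_falling (by omega), h, hmin⟩

/-- An increasing fold in `[0, T w]` pulls back into `[0, w]` when `w` lies on a rising lap. -/
lemma HasIncFold.of_affine {k : ℕ} {a b w : ℝ} (h0 : 0 < a)
    (ha : ∀ x ∈ Icc (S.q (k + 1)) (S.r k), S.T x = a * x + b)
    (hq : a * S.q (k + 1) + b = 0) (hw : w ≤ S.r k)
    (h : S.HasIncFold (a * w + b)) : S.HasIncFold w := by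
  have key : ∀ y, 0 ≤ y → y ≤ a * w + b → ∃ x, a * x + b = y ∧ S.q (k + 1) ≤ x ∧ x ≤ w :=
    fun y h1 h2 => by
      refine ⟨(y - b) / a, by rw [mul_div_cancel₀ _ h0.ne']; ring, ?_, ?_⟩
      · rw [le_div_iff₀ h0]; linarith
      · rw [div_le_iff₀ h0]; linarith
  obtain ⟨n, c, d, h1, h2, h3, hF⟩ := h
  obtain ⟨x, rfl, hx1, hx2⟩ := key c h1 (h2.le.trans h3)
  obtain ⟨y, rfl, hy1, hy2⟩ := key d (h1.trans h2.le) h3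
  exact ⟨n + 1, x, y, (S.hq_pos _ (by omega)).le.trans hx1, by nlinarith, hy2,
    hF.pullback ha ⟨hx1, hx2.trans hw⟩ ⟨hy1, hy2.trans hw⟩⟩

lemma HasIncFold.succ {k : ℕ} (hk : S.kstar ≤ k) (h : S.HasIncFold (S.p k)) :
    S.HasIncFold (S.p (k + 1)) := by
  have hk1 : 1 ≤ k := S.hkstar.trans hk
  obtain ⟨a, b, h0, ha, hq, hr⟩ := S.exists_affine_rising k
  have he := S.he_mem k hk1
  have hfix := ha _ (Ioo_subset_Icc_self he)
  rw [S.he_fix k hk1] at hfix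
  have hpr := S.hpr k hk1
  have h1a : 1 < a := by nlinarith [he.2]
  have hbig : S.e k < S.p (k + 1) := by simpa using S.hp_e_big (k + 1) (by omega)
  have hre : 0 < S.r k - S.e k := sub_pos.2 he.2
  have hstep : ∀ j : ℕ, S.HasIncFold (S.e k + (S.r k - S.e k) / a ^ j) := by
    intro j
    induction j with
    | zero =>
      refine HasIncFold.of_affine S h0 ha hq (by simp) ?_
      simpa [hr] using h
    | succ j ih =>
      refine HasIncFold.of_affine S h0 ha hq ?_ ?_
      · have := div_le_self hre.le (one_le_pow₀ h1a.le : 1 ≤ a ^ (j + 1))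
        linarith
      · have : a * (S.e k + (S.r k - S.e k) / a ^ (j + 1)) + b =
            S.e k + (S.r k - S.e k) / a ^ j := by
          have : a * ((S.r k - S.e k) / a ^ (j + 1)) = (S.r k - S.e k) / a ^ j := by
            rw [pow_succ]; field_simp
          linear_combination this - hfix
        rwa [this]
  obtain ⟨j, hj⟩ := pow_unbounded_of_one_lt ((S.r k - S.e k) / (S.p (k + 1) - S.e k)) h1a
  refine (hstep j).mono ?_
  have : (S.r k - S.e k) / a ^ j < S.p (k + 1) - S.e k := by
    rw [div_lt_iff₀ (sub_pos.2 hbig)] at hj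
    rw [div_lt_iff₀ (pow_pos h0 j)]
    linarith
  linarith

lemma hasIncFold_p {k : ℕ} (hk : S.kstar ≤ k) : S.HasIncFold (S.p k) := by
  induction k, hk using Nat.le_induction with
  | base =>
    refine ⟨0, 0, S.p S.kstar, le_rfl, S.hp_pos _, le_rfl, rfl, rfl, fun i hi => ?_⟩
    obtain rfl : i = 0 := by omega
    exact ⟨1, 0, fun x _ => by simp⟩
  | succ k hk ih => exact HasIncFold.succ S hk ih

lemma hasFolds_zero {v : ℝ} (hv : 0 < v) : S.HasFolds 0 v := by
  obtain ⟨k, hqk, hk⟩ := ((S.hq_lim.eventually (gt_mem_nhds hv)).and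
    (Filter.eventually_ge_atTop S.kstar)).exists
  have hk1 : 1 ≤ k := S.hkstar.trans hk
  obtain ⟨n, c, d, h1, h2, h3, hF⟩ := S.hasIncFold_p hk
  have hrq := S.hrq k hk1
  have hr0 := S.hr_pos k
  have hq0 := S.hq_pos (k + 1) (by omega)
  constructor
  · obtain ⟨a, b, h0, ha, hq, hr⟩ := S.exists_affine_rising k
    have key : ∀ y, 0 ≤ y → y ≤ S.p k → ∃ x, a * x + b = y ∧ x ∈ Icc (S.q (k + 1)) (S.r k) :=
      fun y h1 h2 => by
        refine ⟨(y - b) / a, by rw [mul_div_cancel₀ _ h0.ne']; ring, ?_, ?_⟩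
        · rw [le_div_iff₀ h0]; linarith
        · rw [div_le_iff₀ h0]; linarith
    obtain ⟨x, rfl, hx⟩ := key c h1 (h2.le.trans h3)
    obtain ⟨y, rfl, hy⟩ := key d (h1.trans h2.le) h3
    exact ⟨n + 1, x, y, hq0.trans_le hx.1, by nlinarith, by linarith [hy.2],
      hF.pullback ha hx hy⟩
  · obtain ⟨a, b, h0, ha, hq, hr⟩ := S.exists_affine_falling hk1
    have key : ∀ y, 0 ≤ y → y ≤ S.p k → ∃ x, a * x + b = y ∧ x ∈ Icc (S.r k) (S.q k) :=
      fun y h1 h2 => by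
        refine ⟨(y - b) / a, by rw [mul_div_cancel₀ _ h0.ne]; ring, ?_, ?_⟩
        · rw [le_div_iff_of_neg h0]; linarith
        · rw [div_le_iff_of_neg h0]; linarith
    obtain ⟨x, rfl, hx⟩ := key c h1 (h2.le.trans h3)
    obtain ⟨y, rfl, hy⟩ := key d (h1.trans h2.le) h3
    exact ⟨n + 1, x, y, hr0.trans_le hy.1, by nlinarith, hx.2.trans_lt hqk,
      hF.pullback ha hx hy⟩

/-- Folds of both orientations accumulate, from either side, at every preimage of `0`. -/
lemma hasFolds_of_iterate_eq_zero (m : ℕ) : ∀ x, 0 ≤ x → x < S.r 0 → S.T^[m] x = 0 →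
    (∀ v, x < v → S.HasFolds x v) ∧ (0 < x → ∀ u, u < x → S.HasFolds u x) := by
  induction m with
  | zero =>
    intro x _ _ hT
    obtain rfl : x = 0 := hT
    exact ⟨fun v hv => S.hasFolds_zero hv, fun h => absurd h (lt_irrefl _)⟩
  | succ m ih =>
    intro x hx0 hxr hT
    rw [Function.iterate_succ_apply] at hT
    rcases hx0.eq_or_lt with rfl | hx
    · exact ⟨fun v hv => S.hasFolds_zero hv, fun h => absurd h (lt_irrefl _)⟩
    constructor
    · intro v hv
      obtain ⟨s, t, ⟨a, b, ha, h⟩, hs, ht⟩ := S.exists_isLap_right hx hxr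
      have hw : x < min v t := lt_min hv ht
      have hxm := h x ⟨hs, ht.le⟩
      have hwm := h (min v t) ⟨hs.trans hw.le, min_le_right _ _⟩
      obtain ⟨hR, hL⟩ := ih (S.T x) hxm.2.1 (hxm.2.2.trans_lt S.hp0r0) hT
      rw [hwm.1] at hwm
      rw [hxm.1] at hR hL
      refine HasFolds.mono ?_ le_rfl (min_le_left v t)
      have hsub : ∀ y ∈ Icc x (min v t), S.T y = a * y + b := fun y hy =>
        (h y ⟨hs.trans hy.1, hy.2.trans (min_le_right _ _)⟩).1
      rcases ha.lt_or_gt with ha | ha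
      · have : a * min v t + b < a * x + b := by nlinarith
        exact .pullback_neg ha hsub (hL (hwm.2.1.trans_lt this) _ this)
      · exact .pullback_pos ha hsub (hR _ (by nlinarith))
    · intro _ u hu
      obtain ⟨s, t, ⟨a, b, ha, h⟩, hs, ht⟩ := S.exists_isLap_left hx hxr
      have hw : max u s < x := max_lt hu hs
      have hxm := h x ⟨hs.le, ht⟩
      have hwm := h (max u s) ⟨le_max_right _ _, hw.le.trans ht⟩
      obtain ⟨hR, hL⟩ := ih (S.T x) hxm.2.1 (hxm.2.2.trans_lt S.hp0r0) hT
      rw [hwm.1] at hwm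
      rw [hxm.1] at hR hL
      refine HasFolds.mono ?_ (le_max_left u s) le_rfl
      have hsub : ∀ y ∈ Icc (max u s) x, S.T y = a * y + b := fun y hy =>
        (h y ⟨(le_max_right _ _).trans hy.1, hy.2.trans ht⟩).1
      rcases ha.lt_or_gt with ha | ha
      · exact .pullback_neg ha hsub (hR _ (by nlinarith))
      · have : a * max u s + b < a * x + b := by nlinarith
        exact .pullback_pos ha hsub (hL (hwm.2.1.trans_lt this) _ this)

variable {S}

lemma Fold.image_eq {n : ℕ} {c d : ℝ} (h : S.Fold n c d) : S.T^[n] '' uIcc c d = S.Jstar := by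
  obtain ⟨h0, hp, haff⟩ := h
  obtain ⟨a, b, hab⟩ := haff n le_rfl
  have hc := hab c left_mem_uIcc
  have hd := hab d right_mem_uIcc
  have himg : (fun x => a * x + b) '' uIcc c d = uIcc (a * c + b) (a * d + b) := by
    rw [← image_image (· + b) (a * ·), image_const_mul_uIcc, image_add_const_uIcc]
  rw [image_congr hab, himg, ← hc, ← hd, h0, hp, uIcc_of_le (S.hp_pos _).le, Jstar]

end SawMapSetup

/-- Under the saw map setup, for every open interval `(a, b)` intersecting `Σ` there is a
segment `[c, d] ⊆ (a, b)` and an `n` such that `T^[n] '' [c, d] = J*`, `T^[n] c = 0`, and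
every iterate `T^[i]`, `i ≤ n`, is affine on `[c, d]`. -/
theorem exists_full_fold (S : SawMapSetup) :
    ∀ a b : ℝ, (S.Sig ∩ Set.Ioo a b).Nonempty →
      ∃ c d : ℝ, c < d ∧ Set.Icc c d ⊆ Set.Ioo a b ∧
        ∃ n : ℕ, S.T^[n] '' Set.Icc c d = S.Jstar ∧ S.T^[n] c = 0 ∧
          ∀ i ≤ n, AffOn (S.T^[i]) c d := by
  rintro a b ⟨y, hyS, hy⟩
  obtain ⟨x, hx, ⟨hx0, hxp⟩, n, -, hn⟩ := mem_closure_iff.1 hyS _ isOpen_Ioo hy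
  have hxr : x < S.r 0 :=
    (hxp.trans (S.p_antitone (Nat.zero_le _))).trans_lt S.hp0r0
  obtain ⟨⟨m, c, d, h1, h2, h3, hF⟩, -⟩ :=
    (S.hasFolds_of_iterate_eq_zero n x hx0 hxr hn).1 b hx.2
  refine ⟨c, d, h2, fun z hz => ⟨hx.1.trans (h1.trans_le hz.1), hz.2.trans_lt h3⟩, m, ?_, hF.1, ?_⟩
  · rw [← uIcc_of_le h2.le, hF.image_eq]
  · simpa only [AffOn, uIcc_of_le h2.le] using hF.2.2
end

section
/- Under the saw map setup, if 1/α_{k*} + 1/β_{k*} ≥ 1, then: the set Σ ⊂ J* is a chaotic invariant set for T; the segment J_{k*} = [e_{k*}, p_{k*}] ⊂ J* satisfies T(J_{k*}) ⊆ J_{k*}; and every x ∈ J* \ Σ reaches J_{k*} after finitely many iterations, i.e., there exists n such that T^i(x) ∈ J_{k*} for all i ≥ n. -/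
/-- `A` is a chaotic invariant set for `T`: `A` is closed and invariant, periodic points of
`T` are dense in `A`, `T` has sensitive dependence on initial conditions on `A`, and some
point of `A` has a dense forward orbit in `A`. -/
def IsChaoticInvariantSet (T : ℝ → ℝ) (A : Set ℝ) : Prop :=
  IsClosed A ∧ Set.MapsTo T A A ∧
    (∀ x ∈ A, ∀ ε > 0, ∃ y ∈ A, |x - y| < ε ∧ ∃ n, 1 ≤ n ∧ T^[n] y = y) ∧
    (∃ b > 0, ∀ x ∈ A, ∀ ε > 0, ∃ y ∈ A, |x - y| < ε ∧ ∃ k : ℕ, b < |T^[k] x - T^[k] y|) ∧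
    (∃ z ∈ A, ∀ x ∈ A, ∀ ε > 0, ∃ n : ℕ, |T^[n] z - x| < ε)

/-- `A` covers `B` under `T^[n]`: there is a continuous right inverse of `T^[n]` on `B` with
values in `A`. -/
def Covers (T : ℝ → ℝ) (n : ℕ) (A B : Set ℝ) : Prop :=
  ∃ g : ℝ → ℝ, ContinuousOn g B ∧ Set.MapsTo g B A ∧ ∀ y ∈ B, T^[n] (g y) = y

namespace Covers

variable {T : ℝ → ℝ} {n m : ℕ} {A B C D : Set ℝ}

lemma trans (h₁ : Covers T n A B) (h₂ : Covers T m B C) : Covers T (m + n) A C := by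
  obtain ⟨g, hg, hgm, hgT⟩ := h₁
  obtain ⟨f, hf, hfm, hfT⟩ := h₂
  refine ⟨g ∘ f, hg.comp hf hfm, hgm.comp hfm, fun y hy => ?_⟩
  rw [Function.iterate_add_apply, Function.comp_apply, hgT _ (hfm hy), hfT y hy]

lemma mono (h : Covers T n A B) (hA : A ⊆ C) (hB : D ⊆ B) : Covers T n C D := by
  obtain ⟨g, hg, hgm, hgT⟩ := h
  exact ⟨g, hg.mono hB, fun y hy => hA (hgm (hB hy)), fun y hy => hgT y (hB hy)⟩

lemma of_subset (T : ℝ → ℝ) (h : B ⊆ A) : Covers T 0 A B :=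
  ⟨id, continuousOn_id, h, fun _ _ => rfl⟩

lemma of_affine {c d : ℝ} (hc : c ≠ 0)
    (h : ∀ y ∈ B, (y - d) / c ∈ A ∧ T ((y - d) / c) = c * ((y - d) / c) + d) :
    Covers T 1 A B := by
  refine ⟨fun y => (y - d) / c, by fun_prop, fun y hy => (h y hy).1, fun y hy => ?_⟩
  rw [Function.iterate_one, (h y hy).2]
  field_simp
  ring

end Covers

/-- If every relatively open piece of a compact set `A` covers `A` under some iterate of `T`,
then some point of `A` has a forward orbit which is dense in `A`. -/
lemma exists_dense_orbit_of_covers {T : ℝ → ℝ} {A : Set ℝ} (hA : IsCompact A)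
    (hne : A.Nonempty)
    (h : ∀ x ∈ A, ∀ ε > 0, ∃ n, Covers T n (Metric.ball x ε ∩ A) A) :
    ∃ z ∈ A, ∀ x ∈ A, ∀ ε > 0, ∃ n : ℕ, |T^[n] z - x| < ε := by
  have : Nonempty A := hne.to_subtype
  obtain ⟨u, hu⟩ := TopologicalSpace.exists_dense_seq A
  have h' : ∀ m : ℕ, ∃ n, Covers T n
      (Metric.ball (u m.unpair.1 : ℝ) (1 / ((m.unpair.2 : ℝ) + 1)) ∩ A) A :=
    fun m => h _ (u _).2 _ Nat.one_div_pos_of_nat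
  choose n g hgc hgm hgT using h'
  let G : ℕ → ℝ → ℝ := fun m => Nat.rec id (fun i f => f ∘ g i) m
  let N : ℕ → ℕ := fun m => Nat.rec 0 (fun i k => n i + k) m
  have hgA : ∀ m, Set.MapsTo (g m) A A := fun m y hy => (hgm m hy).2
  have hG : ∀ m, ContinuousOn (G m) A ∧ Set.MapsTo (G m) A A ∧
      ∀ y ∈ A, T^[N m] (G m y) = y := by
    intro m
    induction m with
    | zero => exact ⟨continuousOn_id, fun y hy => hy, fun y _ => rfl⟩
    | succ m ih =>
      obtain ⟨h1, h2, h3⟩ := ih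
      refine ⟨h1.comp (hgc m) (hgA m), h2.comp (hgA m), fun y hy => ?_⟩
      change T^[n m + N m] (G m (g m y)) = y
      rw [Function.iterate_add_apply, h3 _ (hgA m hy), hgT m y hy]
  have hcpt : ∀ m, IsCompact (G m '' A) := fun m => hA.image_of_continuousOn (hG m).1
  obtain ⟨z, hz⟩ := IsCompact.nonempty_iInter_of_sequence_nonempty_isCompact_isClosed
    (fun m => G m '' A)
    (fun m => by
      rintro _ ⟨y, hy, rfl⟩
      exact ⟨g m y, hgA m hy, rfl⟩)
    (fun m => hne.image _) (hcpt 0) (fun m => (hcpt m).isClosed)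
  rw [Set.mem_iInter] at hz
  refine ⟨z, ?_, fun x hx ε hε => ?_⟩
  · obtain ⟨y, hy, rfl⟩ := hz 0
    exact hy
  · obtain ⟨_, hi, i, rfl⟩ := Metric.dense_iff.1 hu ⟨x, hx⟩ (ε / 2) (half_pos hε)
    obtain ⟨j, hj⟩ := exists_nat_one_div_lt (half_pos hε)
    obtain ⟨y, hy, hyz⟩ := hz (Nat.pair i j + 1)
    refine ⟨N (Nat.pair i j), ?_⟩
    have h1 : T^[N (Nat.pair i j)] z = g (Nat.pair i j) y := by
      rw [← hyz]
      exact (hG _).2.2 _ (hgA _ hy)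
    have h2 := (hgm (Nat.pair i j) hy).1
    rw [Nat.unpair_pair, Metric.mem_ball, Real.dist_eq] at h2
    have h3 : |(u i : ℝ) - x| < ε / 2 := by
      have := Metric.mem_ball.1 hi
      rwa [Subtype.dist_eq, Real.dist_eq] at this
    rw [h1]
    calc |g (Nat.pair i j) y - x| ≤ |g (Nat.pair i j) y - u i| + |(u i : ℝ) - x| :=
          abs_sub_le _ _ _
      _ < ε := by linarith

namespace SawMapSetup

variable (S : SawMapSetup)

lemma q_succ_lt {k : ℕ} (hk : 1 ≤ k) : S.q (k + 1) < S.q k :=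
  (S.hqr k hk).trans (S.hrq k hk)

lemma q_le_of_le {j k : ℕ} (hj : 1 ≤ j) (hjk : j ≤ k) : S.q k ≤ S.q j := by
  induction k, hjk using Nat.le_induction with
  | base => exact le_rfl
  | succ k hk ih => exact (S.q_succ_lt (hj.trans hk)).le.trans ih

lemma p_le_of_le {j k : ℕ} (hjk : j ≤ k) : S.p k ≤ S.p j :=
  antitone_nat_of_succ_le (fun k => (S.hp_dec k).le) hjk

lemma one_lt_alpha {k : ℕ} (hk : 1 ≤ k) : 1 < S.alpha k := S.halpha1 k hk

lemma alpha_mul {k : ℕ} (hk : 1 ≤ k) : S.alpha k * (S.r k - S.q (k + 1)) = S.p k :=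
  div_mul_cancel₀ _ (sub_pos.2 (S.hqr k hk)).ne'

lemma beta_mul {k : ℕ} (hk : 1 ≤ k) : S.beta k * (S.q k - S.r k) = S.p k :=
  div_mul_cancel₀ _ (sub_pos.2 (S.hrq k hk)).ne'

lemma beta_pos {k : ℕ} (hk : 1 ≤ k) : 0 < S.beta k :=
  div_pos (S.hp_pos k) (sub_pos.2 (S.hrq k hk))

lemma alpha_le_of_le {j k : ℕ} (hjk : j ≤ k) : S.alpha j ≤ S.alpha k :=
  monotone_nat_of_le_succ (fun k => (S.halpha_mono k).le) hjk

lemma beta_le_of_le {j k : ℕ} (hj : 1 ≤ j) (hjk : j ≤ k) : S.beta j ≤ S.beta k := by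
  induction k, hjk using Nat.le_induction with
  | base => exact le_rfl
  | succ k hk ih => exact ih.trans (S.hbeta_mono k (hj.trans hk)).le

lemma T_left {k : ℕ} (hk : 1 ≤ k) {x : ℝ} (hx : x ∈ Set.Icc (S.q (k + 1)) (S.r k)) :
    S.T x = S.alpha k * (x - S.q (k + 1)) := by
  obtain ⟨m, c, h⟩ := S.haff1 k hk
  have h1 := h _ ⟨le_rfl, (S.hqr k hk).le⟩
  have h2 := h _ ⟨(S.hqr k hk).le, le_rfl⟩
  rw [S.hTq _ (by omega)] at h1
  rw [S.hTr] at h2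
  have h3 : m = S.alpha k := by
    rw [alpha, eq_div_iff (sub_pos.2 (S.hqr k hk)).ne']
    linarith
  rw [h x hx, ← h3]
  linarith

lemma T_right {k : ℕ} (hk : 1 ≤ k) {x : ℝ} (hx : x ∈ Set.Icc (S.r k) (S.q k)) :
    S.T x = S.beta k * (S.q k - x) := by
  obtain ⟨m, c, h⟩ := S.haff2 k hk
  have h1 := h _ ⟨le_rfl, (S.hrq k hk).le⟩
  have h2 := h _ ⟨(S.hrq k hk).le, le_rfl⟩
  rw [S.hTq _ hk] at h2
  rw [S.hTr] at h1
  have h3 : -m = S.beta k := by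
    rw [beta, eq_div_iff (sub_pos.2 (S.hrq k hk)).ne']
    linarith
  rw [h x hx, ← h3]
  linarith

lemma T_tooth {k : ℕ} (hk : 1 ≤ k) {x : ℝ} (hx : x ∈ Set.Icc (S.q (k + 1)) (S.q k)) :
    S.T x = min (S.alpha k * (x - S.q (k + 1))) (S.beta k * (S.q k - x)) := by
  have ha : 0 < S.alpha k := one_pos.trans (S.one_lt_alpha hk)
  have hb := S.beta_pos hk
  have hap := S.alpha_mul hk
  have hbp := S.beta_mul hk
  rcases le_total x (S.r k) with h | h
  · rw [S.T_left hk ⟨hx.1, h⟩, min_eq_left]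
    have := mul_le_mul_of_nonneg_left (sub_le_sub_right h (S.q (k + 1))) ha.le
    have := mul_le_mul_of_nonneg_left (sub_le_sub_left h (S.q k)) hb.le
    linarith
  · rw [S.T_right hk ⟨h, hx.2⟩, min_eq_right]
    have := mul_le_mul_of_nonneg_left (sub_le_sub_right h (S.q (k + 1))) ha.le
    have := mul_le_mul_of_nonneg_left (sub_le_sub_left h (S.q k)) hb.le
    linarith

lemma continuousOn_tooth {k : ℕ} (hk : 1 ≤ k) :
    ContinuousOn S.T (Set.Icc (S.q (k + 1)) (S.q k)) := by
  refine ContinuousOn.congr (f := fun x =>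
    min (S.alpha k * (x - S.q (k + 1))) (S.beta k * (S.q k - x))) ?_ fun x hx => S.T_tooth hk hx
  fun_prop

lemma T_mem_Icc {k : ℕ} (hk : 1 ≤ k) {x : ℝ} (hx : x ∈ Set.Icc (S.q (k + 1)) (S.q k)) :
    S.T x ∈ Set.Icc 0 (S.p k) := by
  have ha : 0 < S.alpha k := one_pos.trans (S.one_lt_alpha hk)
  have hb := S.beta_pos hk
  have hap := S.alpha_mul hk
  have hbp := S.beta_mul hk
  rcases le_total x (S.r k) with h | h
  · rw [S.T_left hk ⟨hx.1, h⟩]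
    refine ⟨mul_nonneg ha.le (sub_nonneg.2 hx.1), ?_⟩
    have := mul_le_mul_of_nonneg_left (sub_le_sub_right h (S.q (k + 1))) ha.le
    linarith
  · rw [S.T_right hk ⟨h, hx.2⟩]
    refine ⟨mul_nonneg hb.le (sub_nonneg.2 hx.2), ?_⟩
    have := mul_le_mul_of_nonneg_left (sub_le_sub_left h (S.q k)) hb.le
    linarith

lemma exists_tooth_right {j : ℕ} {x : ℝ} (h0 : 0 < x) (hx : x < S.q j) :
    ∃ k, j ≤ k ∧ S.q (k + 1) ≤ x ∧ x < S.q k := by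
  classical
  have hex : ∃ i, S.q (j + i + 1) ≤ x := by
    obtain ⟨N, hN⟩ := (S.hq_lim.eventually (gt_mem_nhds h0)).exists_forall_of_atTop
    exact ⟨N, (hN _ (by omega)).le⟩
  refine ⟨j + Nat.find hex, by omega, Nat.find_spec hex, ?_⟩
  rcases Nat.eq_zero_or_pos (Nat.find hex) with h | h
  · rwa [h]
  · have := Nat.find_min hex (Nat.sub_lt h one_pos)
    rw [show j + (Nat.find hex - 1) + 1 = j + Nat.find hex by omega] at this
    exact not_le.1 this

lemma exists_tooth_left {j : ℕ} {x : ℝ} (h0 : 0 < x) (hx : x < S.q j) :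
    ∃ k, j ≤ k ∧ S.q (k + 1) < x ∧ x ≤ S.q k := by
  obtain ⟨k, hk, h1, h2⟩ := S.exists_tooth_right h0 hx
  rcases h1.lt_or_eq with h | h
  · exact ⟨k, hk, h, h2.le⟩
  · exact ⟨k + 1, by omega, h ▸ S.q_succ_lt (by omega), h.ge⟩

lemma continuousAt_T {x : ℝ} (h0 : 0 < x) (hx : x < S.q 1) : ContinuousAt S.T x := by
  rw [continuousAt_iff_continuous_left_right]
  constructor
  · obtain ⟨k, hk, h1, h2⟩ := S.exists_tooth_left h0 hx
    refine (S.continuousOn_tooth hk x ⟨h1.le, h2⟩).mono_of_mem_nhdsWithin ?_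
    filter_upwards [self_mem_nhdsWithin, mem_nhdsWithin_of_mem_nhds (lt_mem_nhds h1)]
      with y hy hy'
    exact ⟨hy'.le, le_trans hy h2⟩
  · obtain ⟨k, hk, h1, h2⟩ := S.exists_tooth_right h0 hx
    refine (S.continuousOn_tooth hk x ⟨h1, h2.le⟩).mono_of_mem_nhdsWithin ?_
    filter_upwards [self_mem_nhdsWithin, mem_nhdsWithin_of_mem_nhds (gt_mem_nhds h2)]
      with y hy hy'
    exact ⟨le_trans h1 hy, hy'.le⟩

lemma e_pos {k : ℕ} (hk : 1 ≤ k) : 0 < S.e k :=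
  (S.hq_pos (k + 1) (by omega)).trans (S.he_mem k hk).1

lemma e_lt_p {k : ℕ} (hk : 1 ≤ k) : S.e k < S.p k :=
  (S.he_mem k hk).2.trans (S.hpr k hk)

lemma alpha_mul_e {k : ℕ} (hk : 1 ≤ k) : S.alpha k * (S.e k - S.q (k + 1)) = S.e k := by
  rw [← S.T_left hk ⟨(S.he_mem k hk).1.le, (S.he_mem k hk).2.le⟩, S.he_fix k hk]

/-- The left branch of the `k`-th tooth covers `[0, p k]`. -/
lemma covers_left {k : ℕ} (hk : 1 ≤ k) :
    Covers S.T 1 (Set.Icc (S.q (k + 1)) (S.r k)) (Set.Icc 0 (S.p k)) := by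
  have ha : 0 < S.alpha k := one_pos.trans (S.one_lt_alpha hk)
  have hap := S.alpha_mul hk
  refine Covers.of_affine (c := S.alpha k) (d := -(S.alpha k * S.q (k + 1))) ha.ne' ?_
  intro y hy
  have hmem : (y - -(S.alpha k * S.q (k + 1))) / S.alpha k ∈
      Set.Icc (S.q (k + 1)) (S.r k) := by
    constructor
    · rw [le_div_iff₀ ha]
      linarith [hy.1]
    · rw [div_le_iff₀ ha]
      linarith [hy.2]
  refine ⟨hmem, ?_⟩
  rw [S.T_left hk hmem]
  ring

/-- Arbitrarily small neighbourhoods of the fixed point `e k` cover `[0, p k]`. -/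
lemma exists_covers_near_e {k : ℕ} (hk : 1 ≤ k) {δ : ℝ} (hδ : 0 < δ) :
    ∃ n, Covers S.T n (Set.Ioo (S.e k - δ) (S.e k + δ) ∩ Set.Icc 0 (S.p k))
      (Set.Icc 0 (S.p k)) := by
  have ha1 := S.one_lt_alpha hk
  have ha : 0 < S.alpha k := one_pos.trans ha1
  have hap := S.alpha_mul hk
  have hae := S.alpha_mul_e hk
  have hiter : ∀ n, ∃ g : ℝ → ℝ, ContinuousOn g (Set.Icc 0 (S.p k)) ∧
      (∀ y ∈ Set.Icc 0 (S.p k), g y ∈ Set.Icc 0 (S.p k) ∧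
        |g y - S.e k| = |y - S.e k| / S.alpha k ^ n) ∧
      ∀ y ∈ Set.Icc 0 (S.p k), S.T^[n] (g y) = y := by
    intro n
    induction n with
    | zero => exact ⟨id, continuousOn_id, fun y hy => ⟨hy, by simp⟩, fun _ _ => rfl⟩
    | succ n ih =>
      obtain ⟨g, hg, hgm, hgT⟩ := ih
      refine ⟨fun y => g y / S.alpha k + S.q (k + 1), by fun_prop, fun y hy => ?_,
        fun y hy => ?_⟩
      · obtain ⟨⟨h1, h2⟩, h3⟩ := hgm y hy
        refine ⟨⟨add_nonneg (div_nonneg h1 ha.le) (S.hq_pos _ (by omega)).le, ?_⟩, ?_⟩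
        · refine le_trans ?_ (S.hpr k hk).le
          rw [← le_sub_iff_add_le, div_le_iff₀ ha]
          linarith
        · have h4 : g y / S.alpha k + S.q (k + 1) - S.e k = (g y - S.e k) / S.alpha k := by
            rw [eq_div_iff ha.ne', sub_mul, add_mul, div_mul_cancel₀ _ ha.ne']
            linarith
          rw [h4, abs_div, abs_of_pos ha, h3, pow_succ, div_div]
      · obtain ⟨⟨h1, h2⟩, h3⟩ := hgm y hy
        have hmem : g y / S.alpha k + S.q (k + 1) ∈ Set.Icc (S.q (k + 1)) (S.r k) := by
          refine ⟨le_add_of_nonneg_left (div_nonneg h1 ha.le), ?_⟩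
          rw [← le_sub_iff_add_le, div_le_iff₀ ha]
          linarith
        rw [Function.iterate_succ_apply, S.T_left hk hmem, add_sub_cancel_right,
          mul_div_cancel₀ _ ha.ne', hgT y hy]
  obtain ⟨n, hn⟩ := pow_unbounded_of_one_lt (S.p k / δ) ha1
  obtain ⟨g, hg, hgm, hgT⟩ := hiter n
  refine ⟨n, g, hg, fun y hy => ⟨?_, (hgm y hy).1⟩, hgT⟩
  have h1 : |y - S.e k| ≤ S.p k :=
    abs_le.2 ⟨by linarith [hy.1, S.e_lt_p hk], by linarith [hy.2, S.e_pos hk]⟩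
  have h2 : |g y - S.e k| < δ := by
    rw [(hgm y hy).2, div_lt_iff₀ (pow_pos ha n)]
    rw [div_lt_iff₀ hδ] at hn
    linarith
  rw [abs_lt] at h2
  exact ⟨by linarith, by linarith⟩

lemma e_kstar_lt : S.e S.kstar < S.p (S.kstar + 1) := by
  simpa using S.hp_e_big (S.kstar + 1) le_rfl

/-- For `k > kstar`, the interval `[0, p k]` covers `[0, e kstar]` under some iterate. -/
lemma exists_covers_zero_p {k : ℕ} (hk : S.kstar + 1 ≤ k) :
    ∃ n, Covers S.T n (Set.Icc 0 (S.p k)) (Set.Icc 0 (S.e S.kstar)) := by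
  induction k, hk using Nat.le_induction with
  | base => exact ⟨0, Covers.of_subset _ (Set.Icc_subset_Icc_right S.e_kstar_lt.le)⟩
  | succ k hk ih =>
    obtain ⟨n, hn⟩ := ih
    have he : S.e k < S.p (k + 1) := by simpa using S.hp_e_big (k + 1) (by omega)
    obtain ⟨m, hm⟩ := S.exists_covers_near_e (k := k) (by omega) (sub_pos.2 he)
    refine ⟨n + m, (hm.mono ?_ subset_rfl).trans hn⟩
    rintro y ⟨h1, h2⟩
    exact ⟨h2.1, by linarith [h1.2]⟩

lemma exists_covers_right_zero {ε : ℝ} (hε : 0 < ε) :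
    ∃ n, 1 ≤ n ∧ Covers S.T n (Set.Ioo 0 ε) (Set.Icc 0 (S.e S.kstar)) := by
  obtain ⟨N, hN⟩ := (S.hr_lim.eventually (gt_mem_nhds hε)).exists_forall_of_atTop
  have hk : S.kstar + 1 ≤ max N (S.kstar + 1) := le_max_right _ _
  obtain ⟨n, hn⟩ := S.exists_covers_zero_p hk
  refine ⟨n + 1, by omega, ((S.covers_left (by omega)).mono ?_ subset_rfl).trans hn⟩
  intro y hy
  exact ⟨(S.hq_pos _ (by omega)).trans_le hy.1, hy.2.trans_lt (hN _ (le_max_left _ _))⟩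

lemma exists_covers_left_branch_right {k : ℕ} (hk : 1 ≤ k) {x ε : ℝ}
    (h1 : S.q (k + 1) ≤ x) (h2 : x < S.r k) (hε : 0 < ε) :
    ∃ δ > 0, Covers S.T 1 (Set.Ioo x (x + ε)) (Set.Ioo (S.T x) (S.T x + δ)) := by
  have ha : 0 < S.alpha k := one_pos.trans (S.one_lt_alpha hk)
  have hm : 0 < min ε (S.r k - x) := lt_min hε (by linarith)
  refine ⟨S.alpha k * min ε (S.r k - x), mul_pos ha hm,
    Covers.of_affine (c := S.alpha k) (d := -(S.alpha k * S.q (k + 1))) ha.ne' ?_⟩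
  rintro y ⟨hy1, hy2⟩
  rw [S.T_left hk ⟨h1, h2.le⟩] at hy1 hy2
  have h3 : x < (y - -(S.alpha k * S.q (k + 1))) / S.alpha k := by
    rw [lt_div_iff₀ ha]
    linarith
  have h4 : (y - -(S.alpha k * S.q (k + 1))) / S.alpha k < x + min ε (S.r k - x) := by
    rw [div_lt_iff₀ ha]
    linarith
  have h5 := min_le_left ε (S.r k - x)
  have h6 := min_le_right ε (S.r k - x)
  refine ⟨⟨h3, by linarith⟩, ?_⟩
  rw [S.T_left hk ⟨by linarith, by linarith⟩]
  ring

lemma exists_covers_left_branch_left {k : ℕ} (hk : 1 ≤ k) {x ε : ℝ}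
    (h1 : S.q (k + 1) < x) (h2 : x ≤ S.r k) (hε : 0 < ε) :
    ∃ δ > 0, Covers S.T 1 (Set.Ioo (x - ε) x) (Set.Ioo (S.T x - δ) (S.T x)) := by
  have ha : 0 < S.alpha k := one_pos.trans (S.one_lt_alpha hk)
  have hm : 0 < min ε (x - S.q (k + 1)) := lt_min hε (by linarith)
  refine ⟨S.alpha k * min ε (x - S.q (k + 1)), mul_pos ha hm,
    Covers.of_affine (c := S.alpha k) (d := -(S.alpha k * S.q (k + 1))) ha.ne' ?_⟩
  rintro y ⟨hy1, hy2⟩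
  rw [S.T_left hk ⟨h1.le, h2⟩] at hy1 hy2
  have h3 : x - min ε (x - S.q (k + 1)) < (y - -(S.alpha k * S.q (k + 1))) / S.alpha k := by
    rw [lt_div_iff₀ ha]
    linarith
  have h4 : (y - -(S.alpha k * S.q (k + 1))) / S.alpha k < x := by
    rw [div_lt_iff₀ ha]
    linarith
  have h5 := min_le_left ε (x - S.q (k + 1))
  have h6 := min_le_right ε (x - S.q (k + 1))
  refine ⟨⟨by linarith, h4⟩, ?_⟩
  rw [S.T_left hk ⟨by linarith, by linarith⟩]
  ring

lemma exists_covers_right_branch_right {k : ℕ} (hk : 1 ≤ k) {x ε : ℝ}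
    (h1 : S.r k ≤ x) (h2 : x < S.q k) (hε : 0 < ε) :
    ∃ δ > 0, Covers S.T 1 (Set.Ioo x (x + ε)) (Set.Ioo (S.T x - δ) (S.T x)) := by
  have hb := S.beta_pos hk
  have hm : 0 < min ε (S.q k - x) := lt_min hε (by linarith)
  refine ⟨S.beta k * min ε (S.q k - x), mul_pos hb hm,
    Covers.of_affine (c := -S.beta k) (d := S.beta k * S.q k) (neg_ne_zero.2 hb.ne') ?_⟩
  rintro y ⟨hy1, hy2⟩
  rw [S.T_right hk ⟨h1, h2.le⟩] at hy1 hy2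
  rw [div_neg, ← neg_div, neg_sub]
  have h3 : x < (S.beta k * S.q k - y) / S.beta k := by
    rw [lt_div_iff₀ hb]
    linarith
  have h4 : (S.beta k * S.q k - y) / S.beta k < x + min ε (S.q k - x) := by
    rw [div_lt_iff₀ hb]
    linarith
  have h5 := min_le_left ε (S.q k - x)
  have h6 := min_le_right ε (S.q k - x)
  refine ⟨⟨h3, by linarith⟩, ?_⟩
  rw [S.T_right hk ⟨by linarith, by linarith⟩]
  ring

lemma exists_covers_right_branch_left {k : ℕ} (hk : 1 ≤ k) {x ε : ℝ}
    (h1 : S.r k < x) (h2 : x ≤ S.q k) (hε : 0 < ε) :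
    ∃ δ > 0, Covers S.T 1 (Set.Ioo (x - ε) x) (Set.Ioo (S.T x) (S.T x + δ)) := by
  have hb := S.beta_pos hk
  have hm : 0 < min ε (x - S.r k) := lt_min hε (by linarith)
  refine ⟨S.beta k * min ε (x - S.r k), mul_pos hb hm,
    Covers.of_affine (c := -S.beta k) (d := S.beta k * S.q k) (neg_ne_zero.2 hb.ne') ?_⟩
  rintro y ⟨hy1, hy2⟩
  rw [S.T_right hk ⟨h1.le, h2⟩] at hy1 hy2
  rw [div_neg, ← neg_div, neg_sub]
  have h3 : x - min ε (x - S.r k) < (S.beta k * S.q k - y) / S.beta k := by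
    rw [lt_div_iff₀ hb]
    linarith
  have h4 : (S.beta k * S.q k - y) / S.beta k < x := by
    rw [div_lt_iff₀ hb]
    linarith
  have h5 := min_le_left ε (x - S.r k)
  have h6 := min_le_right ε (x - S.r k)
  refine ⟨⟨by linarith, h4⟩, ?_⟩
  rw [S.T_right hk ⟨by linarith, by linarith⟩]
  ring

lemma p_add_q_le (hslope : 1 ≤ 1 / S.alpha S.kstar + 1 / S.beta S.kstar) :
    S.p S.kstar + S.q (S.kstar + 1) ≤ S.q S.kstar := by
  rw [alpha, beta, one_div_div, one_div_div, ← add_div, one_le_div (S.hp_pos _)] at hslope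
  linarith

lemma zero_mem_Jstar : (0 : ℝ) ∈ S.Jstar := ⟨le_rfl, (S.hp_pos _).le⟩

lemma q_lt_e_kstar {k : ℕ} (hk : S.kstar + 1 ≤ k) : S.q k < S.e S.kstar :=
  (S.q_le_of_le (by omega) hk).trans_lt (S.he_mem _ S.hkstar).1

lemma zero_mem_Omega : (0 : ℝ) ∈ S.Omega := ⟨S.zero_mem_Jstar, 1, le_rfl, S.hT0⟩

lemma mem_Omega_of_iterate {x : ℝ} (hx : x ∈ S.Jstar) {n : ℕ} (h : S.T^[n] x ∈ S.Omega) :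
    x ∈ S.Omega := by
  obtain ⟨-, m, hm, hm0⟩ := h
  exact ⟨hx, m + n, by omega, by rwa [Function.iterate_add_apply]⟩

lemma q_mem_Omega {k : ℕ} (hk : S.kstar + 1 ≤ k) : S.q k ∈ S.Omega :=
  ⟨⟨(S.hq_pos _ (by omega)).le, ((S.q_lt_e_kstar hk).trans (S.e_lt_p S.hkstar)).le⟩, 1, le_rfl,
    S.hTq _ (by omega)⟩

section LowPeak

variable {S}

lemma p_kstar_lt_q (h : S.p S.kstar + S.q (S.kstar + 1) ≤ S.q S.kstar) :
    S.p S.kstar < S.q S.kstar := by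
  linarith [S.hq_pos (S.kstar + 1) (by omega)]

lemma mapsTo_Jstar (h : S.p S.kstar + S.q (S.kstar + 1) ≤ S.q S.kstar) :
    Set.MapsTo S.T S.Jstar S.Jstar := by
  rintro x ⟨h0, h1⟩
  rcases h0.eq_or_lt with rfl | h0
  · rw [S.hT0]
    exact S.zero_mem_Jstar
  · obtain ⟨k, hk, h2, h3⟩ := S.exists_tooth_right h0 (h1.trans_lt (p_kstar_lt_q h))
    have := S.T_mem_Icc (S.hkstar.trans hk) ⟨h2, h3.le⟩
    exact ⟨this.1, this.2.trans (S.p_le_of_le hk)⟩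

lemma mapsTo_Jk (h : S.p S.kstar + S.q (S.kstar + 1) ≤ S.q S.kstar) :
    Set.MapsTo S.T (S.Jk S.kstar) (S.Jk S.kstar) := by
  have hk := S.hkstar
  have ha : 0 < S.alpha S.kstar := one_pos.trans (S.one_lt_alpha hk)
  have hb := S.beta_pos hk
  have hap := S.alpha_mul hk
  have hbp := S.beta_mul hk
  have hae := S.alpha_mul_e hk
  have hpq := p_kstar_lt_q h
  have hep := S.e_lt_p hk
  obtain ⟨he1, he2⟩ := S.he_mem _ hk
  rintro x ⟨h1, h2⟩
  have hx := S.T_mem_Icc hk ⟨he1.le.trans h1, h2.trans hpq.le⟩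
  refine ⟨?_, hx.2⟩
  rcases le_total x (S.r S.kstar) with hr | hr
  · rw [S.T_left hk ⟨he1.le.trans h1, hr⟩]
    have := mul_le_mul_of_nonneg_left (sub_le_sub_right h1 (S.q (S.kstar + 1))) ha.le
    linarith
  · rw [S.T_right hk ⟨hr, h2.trans hpq.le⟩]
    have h3 : S.e S.kstar ≤ S.beta S.kstar * (S.q S.kstar - S.p S.kstar) := by
      rw [beta, div_mul_eq_mul_div, le_div_iff₀ (sub_pos.2 (S.hrq _ hk))]
      have h4 : S.e S.kstar * (S.p S.kstar - S.r S.kstar) =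
          S.q (S.kstar + 1) * (S.p S.kstar - S.e S.kstar) := by
        linear_combination (S.q (S.kstar + 1) - S.e S.kstar) * hap +
          (S.r S.kstar - S.q (S.kstar + 1)) * hae
      have h5 := mul_le_mul_of_nonneg_right
        (show S.q (S.kstar + 1) ≤ S.q S.kstar - S.p S.kstar by linarith)
        (sub_nonneg.2 hep.le)
      linarith
    have := mul_le_mul_of_nonneg_left (sub_le_sub_left h2 (S.q S.kstar)) hb.le
    linarith

lemma lt_e_of_mem_Omega (h : S.p S.kstar + S.q (S.kstar + 1) ≤ S.q S.kstar) {x : ℝ}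
    (hx : x ∈ S.Omega) : x < S.e S.kstar := by
  by_contra hxe
  obtain ⟨hJ, n, -, hn⟩ := hx
  have := (mapsTo_Jk h).iterate n (show x ∈ S.Jk S.kstar from ⟨not_lt.1 hxe, hJ.2⟩)
  rw [hn] at this
  linarith [this.1, S.e_pos S.hkstar]

lemma mapsTo_Omega (h : S.p S.kstar + S.q (S.kstar + 1) ≤ S.q S.kstar) :
    Set.MapsTo S.T S.Omega S.Omega := by
  rintro x ⟨hJ, n, hn, h0⟩
  refine ⟨mapsTo_Jstar h hJ, n, hn, ?_⟩
  rw [← Function.iterate_succ_apply, Function.iterate_succ_apply', h0, S.hT0]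

lemma Sig_subset_Icc (h : S.p S.kstar + S.q (S.kstar + 1) ≤ S.q S.kstar) :
    S.Sig ⊆ Set.Icc 0 (S.e S.kstar) :=
  closure_minimal (fun _ hx => ⟨hx.1.1, (lt_e_of_mem_Omega h hx).le⟩) isClosed_Icc

lemma mapsTo_Sig (h : S.p S.kstar + S.q (S.kstar + 1) ≤ S.q S.kstar) :
    Set.MapsTo S.T S.Sig S.Sig := by
  intro x hx
  obtain ⟨h0, h1⟩ := Sig_subset_Icc h hx
  rcases h0.eq_or_lt with rfl | h0
  · rwa [S.hT0]
  · have hx1 : x < S.q 1 := by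
      linarith [S.e_lt_p S.hkstar, p_kstar_lt_q h, S.q_le_of_le le_rfl S.hkstar]
    exact (S.continuousAt_T h0 hx1).continuousWithinAt.mem_closure hx (mapsTo_Omega h)

/-- Points of `Omega` accumulate at `e kstar` from the left. -/
lemma exists_mem_Omega_near_e (h : S.p S.kstar + S.q (S.kstar + 1) ≤ S.q S.kstar) {x : ℝ}
    (hx : x < S.e S.kstar) : ∃ y ∈ S.Omega, x < y ∧ y < S.e S.kstar := by
  obtain ⟨n, g, -, hgm, hgT⟩ := S.exists_covers_near_e S.hkstar (sub_pos.2 hx)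
  obtain ⟨h1, h2⟩ := hgm (x := 0) S.zero_mem_Jstar
  have h3 : g 0 ∈ S.Omega := by
    refine S.mem_Omega_of_iterate h2 (n := n) ?_
    rw [hgT 0 S.zero_mem_Jstar]
    exact S.zero_mem_Omega
  exact ⟨g 0, h3, by linarith [h1.1], lt_e_of_mem_Omega h h3⟩

/-- Every one-sided neighbourhood of a point of `Omega` covers `[0, e kstar]`. -/
lemma exists_covers_of_iterate_eq_zero (h : S.p S.kstar + S.q (S.kstar + 1) ≤ S.q S.kstar)
    (n : ℕ) {x : ℝ} (hx : x ∈ S.Jstar) (hn : S.T^[n] x = 0) :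
    (∀ ε > 0, ∃ m, 1 ≤ m ∧ Covers S.T m (Set.Ioo x (x + ε)) (Set.Icc 0 (S.e S.kstar))) ∧
    (0 < x → ∀ ε > 0, ∃ m, 1 ≤ m ∧
      Covers S.T m (Set.Ioo (x - ε) x) (Set.Icc 0 (S.e S.kstar))) := by
  have hzero : (∀ ε > 0, ∃ m, 1 ≤ m ∧
      Covers S.T m (Set.Ioo (0 : ℝ) (0 + ε)) (Set.Icc 0 (S.e S.kstar))) := by
    intro ε hε
    rw [zero_add]
    exact S.exists_covers_right_zero hε
  induction n generalizing x with
  | zero =>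
    obtain rfl : x = 0 := hn
    exact ⟨hzero, fun h0 => absurd h0 (lt_irrefl _)⟩
  | succ n ih =>
    rcases hx.1.eq_or_lt with rfl | h0
    · exact ⟨hzero, fun h0 => absurd h0 (lt_irrefl _)⟩
    obtain ⟨hR, hL⟩ := ih (mapsTo_Jstar h hx) hn
    have hxq : x < S.q S.kstar := hx.2.trans_lt (p_kstar_lt_q h)
    have key : ∀ {A B : Set ℝ}, Covers S.T 1 A B →
        (∃ m, 1 ≤ m ∧ Covers S.T m B (Set.Icc 0 (S.e S.kstar))) →
        ∃ m, 1 ≤ m ∧ Covers S.T m A (Set.Icc 0 (S.e S.kstar)) := by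
      rintro A B h1 ⟨m, -, h2⟩
      exact ⟨m + 1, by omega, h1.trans h2⟩
    constructor
    · intro ε hε
      obtain ⟨k, hk, h1, h2⟩ := S.exists_tooth_right h0 hxq
      have hk1 := S.hkstar.trans hk
      rcases lt_or_ge x (S.r k) with h3 | h3
      · obtain ⟨δ, hδ, hc⟩ := S.exists_covers_left_branch_right hk1 h1 h3 hε
        exact key hc (hR δ hδ)
      · obtain ⟨δ, hδ, hc⟩ := S.exists_covers_right_branch_right hk1 h3 h2 hε
        refine key hc (hL ?_ δ hδ)
        rw [S.T_right hk1 ⟨h3, h2.le⟩]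
        exact mul_pos (S.beta_pos hk1) (sub_pos.2 h2)
    · intro _ ε hε
      obtain ⟨k, hk, h1, h2⟩ := S.exists_tooth_left h0 hxq
      have hk1 := S.hkstar.trans hk
      rcases le_or_gt x (S.r k) with h3 | h3
      · obtain ⟨δ, hδ, hc⟩ := S.exists_covers_left_branch_left hk1 h1 h3 hε
        refine key hc (hL ?_ δ hδ)
        rw [S.T_left hk1 ⟨h1.le, h3⟩]
        exact mul_pos (one_pos.trans (S.one_lt_alpha hk1)) (sub_pos.2 h1)
      · obtain ⟨δ, hδ, hc⟩ := S.exists_covers_right_branch_left hk1 h3 h2 hε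
        exact key hc (hR δ hδ)

lemma exists_covers_ball (h : S.p S.kstar + S.q (S.kstar + 1) ≤ S.q S.kstar) {x : ℝ}
    (hx : x ∈ S.Sig) {ε : ℝ} (hε : 0 < ε) :
    ∃ n, 1 ≤ n ∧ Covers S.T n (Metric.ball x ε ∩ Set.Ico 0 (S.e S.kstar))
      (Set.Icc 0 (S.e S.kstar)) := by
  obtain ⟨w, hw, hwx⟩ := Metric.mem_closure_iff.1 hx (ε / 2) (half_pos hε)
  have hwe := lt_e_of_mem_Omega h hw
  obtain ⟨hwJ, m, -, hm⟩ := hw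
  obtain ⟨n, hn, hc⟩ := (exists_covers_of_iterate_eq_zero h m hwJ hm).1
    (min (ε / 2) (S.e S.kstar - w)) (lt_min (half_pos hε) (sub_pos.2 hwe))
  refine ⟨n, hn, hc.mono ?_ subset_rfl⟩
  rintro y ⟨h1, h2⟩
  have h3 := min_le_left (ε / 2) (S.e S.kstar - w)
  have h4 := min_le_right (ε / 2) (S.e S.kstar - w)
  rw [Real.dist_eq, abs_lt] at hwx
  refine ⟨?_, hwJ.1.trans h1.le, by linarith⟩
  rw [Metric.mem_ball, Real.dist_eq, abs_lt]
  constructor <;> linarith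

lemma covers_Sig (h : S.p S.kstar + S.q (S.kstar + 1) ≤ S.q S.kstar) {A : Set ℝ} {n : ℕ}
    (hA : A ⊆ S.Jstar) (hc : Covers S.T n A (Set.Icc 0 (S.e S.kstar))) :
    Covers S.T n (A ∩ S.Sig) S.Sig := by
  obtain ⟨g, hg, hgm, hgT⟩ := hc
  have hsub := Sig_subset_Icc h
  have hO : Set.MapsTo g S.Omega S.Omega := fun y hy => by
    have hy' := hsub (subset_closure hy)
    exact S.mem_Omega_of_iterate (hA (hgm hy')) (n := n) (by rwa [hgT y hy'])
  refine ⟨g, hg.mono hsub, fun y hy => ⟨hgm (hsub hy), ?_⟩, fun y hy => hgT y (hsub hy)⟩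
  exact ((hg y (hsub hy)).mono (subset_closure.trans hsub)).mem_closure hy hO

/-- Intervals avoiding `Omega` and lying below `e kstar` are expanded by `T` by a uniform
factor. -/
lemma exists_expansion (h : S.p S.kstar + S.q (S.kstar + 1) ≤ S.q S.kstar) :
    ∃ c : ℝ, 0 < c ∧ c < 1 ∧ ∀ a b : ℝ, 0 ≤ a → a ≤ b → b < S.e S.kstar →
      (∀ y ∈ Set.Icc a b, y ∉ S.Omega) →
      ContinuousOn S.T (Set.Icc a b) ∧ ∃ u ∈ Set.Icc a b, ∃ v ∈ Set.Icc a b,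
        b - a ≤ c * (S.T v - S.T u) := by
  have hK := S.hkstar
  have hK1 : 1 ≤ S.kstar + 1 := by omega
  have ha := S.one_lt_alpha hK
  refine ⟨max (1 / S.alpha S.kstar)
    (1 / S.alpha (S.kstar + 1) + 1 / S.beta (S.kstar + 1)),
    lt_max_of_lt_left (one_div_pos.2 (one_pos.trans ha)), max_lt ?_ ?_, ?_⟩
  · rw [div_lt_one (one_pos.trans ha)]
    exact ha
  · rw [alpha, beta, one_div_div, one_div_div, ← add_div, div_lt_one (S.hp_pos _)]
    have h1 := S.e_kstar_lt
    have h2 := (S.he_mem _ hK).1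
    have h3 := S.hq_pos (S.kstar + 1 + 1) (by omega)
    linarith
  intro a b h0 hab hbe hO
  set c := max (1 / S.alpha S.kstar)
    (1 / S.alpha (S.kstar + 1) + 1 / S.beta (S.kstar + 1))
  have ha0 : 0 < a := h0.lt_of_ne fun h' =>
    hO a ⟨le_rfl, hab⟩ (h' ▸ S.zero_mem_Omega)
  have heq : S.e S.kstar < S.q S.kstar := (S.e_lt_p hK).trans (p_kstar_lt_q h)
  obtain ⟨k, hk, h1, h2⟩ := S.exists_tooth_right ha0 ((hab.trans_lt hbe).trans heq)
  have hk1 := hK.trans hk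
  have hbq : b < S.q k := by
    rcases hk.eq_or_lt with rfl | hk'
    · exact hbe.trans heq
    · by_contra hb
      exact hO _ ⟨h2.le, not_lt.1 hb⟩ (S.q_mem_Omega hk')
  have hα : 0 < S.alpha k := one_pos.trans (S.one_lt_alpha hk1)
  have hβ := S.beta_pos hk1
  have hcα : 1 / S.alpha k ≤ c :=
    (one_div_le_one_div_of_le (one_pos.trans ha) (S.alpha_le_of_le hk)).trans (le_max_left _ _)
  refine ⟨(S.continuousOn_tooth hk1).mono (Set.Icc_subset_Icc h1 hbq.le), ?_⟩
  have hleft : ∀ y, a ≤ y → y ≤ S.r k →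
      y - a = 1 / S.alpha k * (S.T y - S.T a) := by
    intro y hay hyr
    rw [S.T_left hk1 ⟨h1.trans hay, hyr⟩, S.T_left hk1 ⟨h1, hay.trans hyr⟩]
    field_simp
    ring
  have hright : ∀ y, S.r k ≤ y → y ≤ b →
      b - y = 1 / S.beta k * (S.T y - S.T b) := by
    intro y hry hyb
    rw [S.T_right hk1 ⟨hry, hyb.trans hbq.le⟩, S.T_right hk1 ⟨hry.trans hyb, hbq.le⟩]
    field_simp
    ring
  rcases le_total b (S.r k) with hbr | hbr
  · refine ⟨a, ⟨le_rfl, hab⟩, b, ⟨hab, le_rfl⟩, ?_⟩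
    have h3 := hleft b hab hbr
    have h4 : 0 ≤ S.T b - S.T a := by
      by_contra hneg
      have := mul_neg_of_pos_of_neg (one_div_pos.2 hα) (not_le.1 hneg)
      linarith
    rw [h3]
    exact mul_le_mul_of_nonneg_right hcα h4
  · have hk' : S.kstar + 1 ≤ k := by
      rcases hk.eq_or_lt with rfl | hk'
      · exact absurd (hbe.trans (S.he_mem _ hK).2) (not_lt.2 hbr)
      · exact hk'
    have hcαβ : 1 / S.alpha k + 1 / S.beta k ≤ c := by
      refine le_trans (add_le_add ?_ ?_) (le_max_right _ _)
      · exact one_div_le_one_div_of_le (one_pos.trans (S.one_lt_alpha hK1))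
          (S.alpha_le_of_le hk')
      · exact one_div_le_one_div_of_le (S.beta_pos hK1) (S.beta_le_of_le hK1 hk')
    have hα' := one_div_pos.2 hα
    have hβ' := one_div_pos.2 hβ
    rcases le_total a (S.r k) with har | har
    · have h3 := hleft _ har le_rfl
      have h4 := hright _ le_rfl hbr
      have h5 : 0 ≤ S.T (S.r k) - S.T a := by
        by_contra hneg
        have := mul_neg_of_pos_of_neg hα' (not_le.1 hneg)
        linarith
      have h6 : 0 ≤ S.T (S.r k) - S.T b := by
        by_contra hneg
        have := mul_neg_of_pos_of_neg hβ' (not_le.1 hneg)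
        linarith
      rcases le_total (S.T a) (S.T b) with hT | hT
      · refine ⟨a, ⟨le_rfl, hab⟩, S.r k, ⟨har, hbr⟩, ?_⟩
        have h7 := mul_le_mul_of_nonneg_right hcαβ h5
        have h8 := mul_le_mul_of_nonneg_left (sub_le_sub_left hT (S.T (S.r k))) hβ'.le
        linarith
      · refine ⟨b, ⟨hab, le_rfl⟩, S.r k, ⟨har, hbr⟩, ?_⟩
        have h7 := mul_le_mul_of_nonneg_right hcαβ h6
        have h8 := mul_le_mul_of_nonneg_left (sub_le_sub_left hT (S.T (S.r k))) hα'.le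
        linarith
    · refine ⟨b, ⟨hab, le_rfl⟩, a, ⟨le_rfl, hab⟩, ?_⟩
      have h3 := hright a har hab
      have h4 : 0 ≤ S.T a - S.T b := by
        by_contra hneg
        have := mul_neg_of_pos_of_neg hβ' (not_le.1 hneg)
        linarith
      rw [h3]
      exact mul_le_mul_of_nonneg_right (by linarith) h4

/-- A point of `J*` whose orbit stays below `e kstar` belongs to `Σ`. -/
lemma mem_Sig_of_iterate_lt (h : S.p S.kstar + S.q (S.kstar + 1) ≤ S.q S.kstar) {x : ℝ}
    (hx : x ∈ S.Jstar) (hlt : ∀ n, S.T^[n] x < S.e S.kstar) : x ∈ S.Sig := by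
  by_contra hxS
  obtain ⟨ε, hε, hball⟩ := Metric.isOpen_iff.1 isClosed_closure.isOpen_compl x hxS
  have hxe : x < S.e S.kstar := hlt 0
  obtain ⟨c, hc0, hc1, hexp⟩ := exists_expansion h
  set L := min (ε / 2) (S.e S.kstar - x)
  have hLpos : 0 < L := lt_min (half_pos hε) (sub_pos.2 hxe)
  have hmain : ∀ n, ∃ a b, 0 ≤ a ∧ b ≤ S.p S.kstar ∧ S.T^[n] x ∈ Set.Icc a b ∧
      (∀ y ∈ Set.Icc a b, y ∉ S.Omega) ∧ L ≤ c ^ n * (b - a) := by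
    intro n
    induction n with
    | zero =>
      have h1 := min_le_left (ε / 2) (S.e S.kstar - x)
      have h2 := min_le_right (ε / 2) (S.e S.kstar - x)
      refine ⟨x, x + L, hx.1, by linarith [S.e_lt_p S.hkstar], ⟨le_rfl, ?_⟩, ?_, by simp⟩
      · simp [hLpos.le]
      · intro y hy hyO
        refine hball ?_ (subset_closure hyO)
        rw [Metric.mem_ball, Real.dist_eq, abs_lt]
        constructor <;> linarith [hy.1, hy.2]
    | succ n ih =>
      obtain ⟨a, b, ha, hb, hxn, hO, hlen⟩ := ih
      have hab := hxn.1.trans hxn.2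
      have hbe : b < S.e S.kstar := by
        by_contra hbe
        obtain ⟨y, hyO, hy1, hy2⟩ := exists_mem_Omega_near_e h (hlt n)
        exact hO y ⟨hxn.1.trans hy1.le, hy2.le.trans (not_lt.1 hbe)⟩ hyO
      obtain ⟨hcont, u, hu, v, hv, huv⟩ := hexp a b ha hab hbe hO
      have himg := hcont.image_Icc hab
      have hmem : ∀ y ∈ Set.Icc a b, S.T y ∈
          Set.Icc (sInf (S.T '' Set.Icc a b)) (sSup (S.T '' Set.Icc a b)) := by
        intro y hy
        rw [← himg]
        exact ⟨y, hy, rfl⟩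
      have hJ : S.T '' Set.Icc a b ⊆ S.Jstar := by
        rintro _ ⟨y, hy, rfl⟩
        exact mapsTo_Jstar h ⟨ha.trans hy.1, hy.2.trans hb⟩
      have hle := (hmem u hu).1.trans (hmem u hu).2
      refine ⟨sInf (S.T '' Set.Icc a b), sSup (S.T '' Set.Icc a b), ?_, ?_, ?_, ?_, ?_⟩
      · exact (hJ (himg.ge (Set.left_mem_Icc.2 hle))).1
      · exact (hJ (himg.ge (Set.right_mem_Icc.2 hle))).2
      · rw [Function.iterate_succ_apply']
        exact hmem _ hxn
      · intro y hy hyO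
        rw [← himg] at hy
        obtain ⟨z, hz, rfl⟩ := hy
        exact hO z hz (S.mem_Omega_of_iterate (n := 1) ⟨ha.trans hz.1, hz.2.trans hb⟩ hyO)
      · refine hlen.trans ?_
        rw [pow_succ, mul_assoc]
        refine mul_le_mul_of_nonneg_left (huv.trans ?_) (pow_pos hc0 n).le
        exact mul_le_mul_of_nonneg_left (sub_le_sub (hmem v hv).2 (hmem u hu).1) hc0.le
  obtain ⟨n, hn⟩ := exists_pow_lt_of_lt_one (div_pos hLpos (S.hp_pos S.kstar)) hc1
  obtain ⟨a, b, ha, hb, -, -, hlen⟩ := hmain n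
  rw [lt_div_iff₀ (S.hp_pos _)] at hn
  have := mul_le_mul_of_nonneg_left (show b - a ≤ S.p S.kstar by linarith) (pow_pos hc0 n).le
  linarith

lemma exists_iterate_mem_Jk (h : S.p S.kstar + S.q (S.kstar + 1) ≤ S.q S.kstar) {x : ℝ}
    (hx : x ∈ S.Jstar) (hxS : x ∉ S.Sig) :
    ∃ n : ℕ, ∀ i, n ≤ i → S.T^[i] x ∈ S.Jk S.kstar := by
  have h1 : ∃ n, S.e S.kstar ≤ S.T^[n] x := by
    by_contra! hcon
    exact hxS (mem_Sig_of_iterate_lt h hx hcon)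
  obtain ⟨n, hn⟩ := h1
  refine ⟨n, fun i hi => ?_⟩
  obtain ⟨j, rfl⟩ := Nat.exists_eq_add_of_le' hi
  rw [Function.iterate_add_apply]
  exact (mapsTo_Jk h).iterate j ⟨hn, ((mapsTo_Jstar h).iterate n hx).2⟩

lemma isChaoticInvariantSet_Sig (h : S.p S.kstar + S.q (S.kstar + 1) ≤ S.q S.kstar) :
    IsChaoticInvariantSet S.T S.Sig := by
  have hepos := S.e_pos S.hkstar
  have hIco : Set.Ico 0 (S.e S.kstar) ⊆ S.Jstar := fun y hy =>
    ⟨hy.1, (hy.2.trans (S.e_lt_p S.hkstar)).le⟩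
  have hcov : ∀ x ∈ S.Sig, ∀ ε > 0, ∃ n, Covers S.T n (Metric.ball x ε ∩ S.Sig) S.Sig := by
    intro x hx ε hε
    obtain ⟨n, -, hc⟩ := exists_covers_ball h hx hε
    exact ⟨n, (covers_Sig h (Set.inter_subset_right.trans hIco) hc).mono
      (fun y hy => ⟨hy.1.1, hy.2⟩) subset_rfl⟩
  refine ⟨isClosed_closure, mapsTo_Sig h, ?_, ?_, ?_⟩
  · intro x hx ε hε
    obtain ⟨n, hn, g, hg, hgm, hgT⟩ := exists_covers_ball h hx hε
    obtain ⟨y, hy, hgy⟩ := exists_mem_Icc_isFixedPt_of_mapsTo hg hepos.le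
      (fun y hy => Set.Ico_subset_Icc_self (hgm hy).2)
    have hgy' : g y = y := hgy
    have hyI := hgm hy
    rw [hgy'] at hyI
    have hper : S.T^[n] y = y := by
      have := hgT y hy
      rwa [hgy'] at this
    refine ⟨y, ?_, ?_, n, hn, hper⟩
    · by_contra hyS
      obtain ⟨m, hm⟩ := exists_iterate_mem_Jk h (hIco hyI.2) hyS
      have h1 := hm (n * m) (Nat.le_mul_of_pos_left m hn)
      rw [Function.iterate_mul, Function.iterate_fixed hper] at h1
      exact absurd hyI.2.2 (not_lt.2 h1.1)
    · rw [abs_sub_comm]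
      exact hyI.1
  · have hq := S.hq_pos (S.kstar + 1) (by omega)
    refine ⟨S.q (S.kstar + 1) / 3, by positivity, fun x hx ε hε => ?_⟩
    obtain ⟨n, g, -, hgm, hgT⟩ := hcov x hx ε hε
    have hdist : ∀ w ∈ S.Sig, g w ∈ S.Sig ∧ |x - g w| < ε := fun w hw => by
      refine ⟨(hgm hw).2, ?_⟩
      rw [abs_sub_comm]
      exact (hgm hw).1
    have h0 : (0 : ℝ) ∈ S.Sig := subset_closure S.zero_mem_Omega
    have h1 : S.q (S.kstar + 1) ∈ S.Sig := subset_closure (S.q_mem_Omega le_rfl)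
    rcases le_total (S.T^[n] x) (S.q (S.kstar + 1) / 2) with hle | hle
    · refine ⟨_, (hdist _ h1).1, (hdist _ h1).2, n, ?_⟩
      rw [hgT _ h1, lt_abs]
      right
      linarith
    · refine ⟨_, (hdist _ h0).1, (hdist _ h0).2, n, ?_⟩
      rw [hgT _ h0, lt_abs]
      left
      linarith
  · exact exists_dense_orbit_of_covers
      (isCompact_Icc.of_isClosed_subset isClosed_closure (Sig_subset_Icc h))
      ⟨0, subset_closure S.zero_mem_Omega⟩ hcov

end LowPeak

end SawMapSetup

/-- Under the saw map setup, if `1/α kstar + 1/β kstar ≥ 1`, then `Σ ⊂ J*` is a chaotic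
invariant set for `T`, the segment `J kstar ⊂ J*` is invariant, and every point of
`J* \ Σ` eventually stays in `J kstar`. -/
theorem Sig_chaotic_and_Jkstar_absorbs (S : SawMapSetup)
    (hslope : 1 ≤ 1 / S.alpha S.kstar + 1 / S.beta S.kstar) :
    S.Sig ⊂ S.Jstar ∧ IsChaoticInvariantSet S.T S.Sig ∧
    S.Jk S.kstar ⊂ S.Jstar ∧ Set.MapsTo S.T (S.Jk S.kstar) (S.Jk S.kstar) ∧
    ∀ x ∈ S.Jstar, x ∉ S.Sig →
      ∃ n : ℕ, ∀ i, n ≤ i → S.T^[i] x ∈ S.Jk S.kstar := by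
  have h := S.p_add_q_le hslope
  have hpos := S.e_pos S.hkstar
  have hep := S.e_lt_p S.hkstar
  refine ⟨⟨fun x hx => ?_, fun hsub => ?_⟩, SawMapSetup.isChaoticInvariantSet_Sig h,
    ⟨fun x hx => ⟨hpos.le.trans hx.1, hx.2⟩, fun hsub => ?_⟩, SawMapSetup.mapsTo_Jk h,
    fun x hx hxS => SawMapSetup.exists_iterate_mem_Jk h hx hxS⟩
  · have := SawMapSetup.Sig_subset_Icc h hx
    exact ⟨this.1, this.2.trans hep.le⟩
  · have hp : S.p S.kstar ∈ S.Jstar := ⟨(S.hp_pos _).le, le_rfl⟩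
    have := SawMapSetup.Sig_subset_Icc h (hsub hp)
    linarith [this.2]
  · linarith [(hsub S.zero_mem_Jstar).1]
end
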